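/- Let K be an algebraically closed field of positive characteristic and let S ⊆ P^3(K) be an absolutely irreducible cubic surface with infinitely many singular points (non-isolated singularities). Then the set of singular points of S is exactly a projective line ℓ, and ℓ is contained in S. -/

import Mathlib

noncomputable section

open MvPolynomial

variable (K : Type) [Field K]

/-- The zero locus in `P^3(K)` of a (homogeneous) polynomial. -/
def projZeros (F : MvPolynomial (Fin 4) K) : Set (Projectivization K (Fin 4 → K)) :=
  {p | eval p.rep F = 0}

/-- A point is singular for `F` if `F` and all four partial derivatives vanish there. -/
def IsSingularAt (F : MvPolynomial (Fin 4) K) (p : Projectivization K (Fin 4 → K)) : Prop :=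
  eval p.rep F = 0 ∧ ∀ i, eval p.rep (pderiv i F) = 0

/-- The projective line through two points (given via representatives). -/
def lineThrough (p r : Projectivization K (Fin 4 → K)) :
    Set (Projectivization K (Fin 4 → K)) :=
  {s | ∃ (a b : K) (h : a • p.rep + b • r.rep ≠ 0),
      s = Projectivization.mk K (a • p.rep + b • r.rep) h}

section Aux

variable {K : Type} [Field K]

def Sg (F : MvPolynomial (Fin 4) K) (v : Fin 4 → K) : Prop :=
  eval v F = 0 ∧ ∀ i, eval v (pderiv i F) = 0

/-- linear change of variables -/
def chg (M : Matrix (Fin 4) (Fin 4) K) :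
    MvPolynomial (Fin 4) K →ₐ[K] MvPolynomial (Fin 4) K :=
  aeval (fun j => ∑ i, C (M i j) * X i)

lemma chg_comp (M N : Matrix (Fin 4) (Fin 4) K) (h : M * N = 1) (F : MvPolynomial (Fin 4) K) :
    chg M (chg N F) = F := by
  have : (chg M).comp (chg N) = AlgHom.id K _ := by
    apply MvPolynomial.algHom_ext
    intro j
    have h2 : ∀ k, ∑ i, M k i * N i j = (1 : Matrix (Fin 4) (Fin 4) K) k j := by
      intro k; rw [← h, Matrix.mul_apply]
    simp only [AlgHom.comp_apply, chg, aeval_X, map_sum, map_mul, AlgHom.id_apply, algHom_C,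
      algebraMap_eq, Finset.mul_sum]
    rw [Finset.sum_comm]
    have : ∀ k, ∑ i, (C (N i j) * (C (M k i) * X k) : MvPolynomial (Fin 4) K) =
        C ((1 : Matrix (Fin 4) (Fin 4) K) k j) * X k := by
      intro k
      rw [← h2, map_sum, Finset.sum_mul]
      refine Finset.sum_congr rfl fun i _ => ?_
      rw [C_mul]; ring
    simp only [this, Matrix.one_apply]
    simp
  exact DFunLike.congr_fun this F

lemma chg_irr (M N : Matrix (Fin 4) (Fin 4) K) (h : M * N = 1) (h' : N * M = 1)
    (F : MvPolynomial (Fin 4) K) (hF : Irreducible F) : Irreducible (chg M F) := by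
  let e : MvPolynomial (Fin 4) K ≃ₐ[K] MvPolynomial (Fin 4) K :=
    AlgEquiv.ofAlgHom (chg M) (chg N) (AlgHom.ext (chg_comp M N h)) (AlgHom.ext (chg_comp N M h'))
  exact (MulEquiv.irreducible_iff e).2 hF

lemma chg_hom (M : Matrix (Fin 4) (Fin 4) K)
    (F : MvPolynomial (Fin 4) K) (hF : F.IsHomogeneous 3) : (chg M F).IsHomogeneous 3 := by
  have := hF.aeval (fun j => ∑ i, (C (M i j) * X i : MvPolynomial (Fin 4) K)) (n := 1) (by
    intro j
    refine IsHomogeneous.sum _ _ _ fun i _ => ?_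
    simpa using (isHomogeneous_C (Fin 4) (M i j)).mul (isHomogeneous_X K i))
  exact this

lemma eval_chg (M : Matrix (Fin 4) (Fin 4) K) (F : MvPolynomial (Fin 4) K) (x : Fin 4 → K) :
    eval x (chg M F) = eval (Matrix.vecMul x M) F := by
  have : ((eval x : MvPolynomial (Fin 4) K →+* K).comp (chg M : _ →+* _)) = eval (Matrix.vecMul x M) := by
    apply MvPolynomial.ringHom_ext
    · intro r; simp [chg]
    · intro i
      simp [chg, Matrix.vecMul, dotProduct, mul_comm]
  exact DFunLike.congr_fun this F

lemma pderiv_chg (M : Matrix (Fin 4) (Fin 4) K) (F : MvPolynomial (Fin 4) K) (k : Fin 4) :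
    pderiv k (chg M F) = ∑ j, C (M k j) * chg M (pderiv j F) := by
  induction F using MvPolynomial.induction_on with
  | C a => simp [chg]
  | add p q hp hq => simp [hp, hq, mul_add, Finset.sum_add_distrib]
  | mul_X p n hp =>
    have h1 : pderiv k (chg M (X n)) = C (M k n) := by
      simp [chg, pderiv_X, Pi.single_apply]
    have h2 : ∀ j, C (M k j) * chg M (pderiv j (p * X n)) =
      C (M k j) * chg M (pderiv j p) * chg M (X n) + (if j = n then C (M k j) * chg M p else 0) := by
      intro j
      rw [Derivation.leibniz, pderiv_X, Pi.single_apply]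
      by_cases hj : n = j
      · subst hj; simp; ring
      · simp [hj, Ne.symm hj]; ring
    simp only [h2, Finset.sum_add_distrib, ← Finset.sum_mul, ← hp]
    rw [map_mul, Derivation.leibniz, h1]
    simp
    ring

lemma Sg_chg (M : Matrix (Fin 4) (Fin 4) K) (F : MvPolynomial (Fin 4) K) (x : Fin 4 → K)
    (h : Sg F (Matrix.vecMul x M)) : Sg (chg M F) x := by
  refine ⟨by rw [eval_chg]; exact h.1, fun i => ?_⟩
  rw [pderiv_chg]
  simp [eval_chg, h.2]

lemma Sg_of_chg (M N : Matrix (Fin 4) (Fin 4) K) (h1 : M * N = 1) (h' : N * M = 1)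
    (F : MvPolynomial (Fin 4) K) (x : Fin 4 → K)
    (h : Sg (chg M F) x) : Sg F (Matrix.vecMul x M) := by
  have := Sg_chg N (chg M F) (Matrix.vecMul x M) (by simpa [Matrix.vecMul_vecMul, h1] using h)
  rwa [chg_comp N M h'] at this

lemma hom_succ (n : ℕ) (G : MvPolynomial (Fin 4) K) (h : G.IsHomogeneous (n+1)) :
    ∃ Q : Fin 4 → MvPolynomial (Fin 4) K, (∀ i, (Q i).IsHomogeneous n) ∧ G = ∑ i, X i * Q i := by
  rw [G.as_sum]
  refine Finset.sum_induction _ (fun G => ∃ Q : Fin 4 → MvPolynomial (Fin 4) K,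
    (∀ i, (Q i).IsHomogeneous n) ∧ G = ∑ i, X i * Q i) ?_ ?_ ?_
  · rintro _ _ ⟨Q, hQ, rfl⟩ ⟨R, hR, rfl⟩
    exact ⟨Q + R, fun i => (hQ i).add (hR i), by simp [mul_add, Finset.sum_add_distrib]⟩
  · exact ⟨0, fun i => isHomogeneous_zero _ _ _, by simp⟩
  · intro d hd
    have hdeg : d.degree = n + 1 := by
      exact h.degree_eq_sum_deg_support hd |>.symm
    have hd0 : d ≠ 0 := by rintro rfl; simp at hdeg
    obtain ⟨i, hi⟩ := Finsupp.ne_iff.1 hd0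
    have hle : Finsupp.single i 1 ≤ d := by
      rw [Finsupp.single_le_iff]; exact Nat.one_le_iff_ne_zero.2 hi
    obtain ⟨e, rfl⟩ := exists_add_of_le hle
    refine ⟨Pi.single i (monomial e (coeff (Finsupp.single i 1 + e) G)), fun j => ?_, ?_⟩
    · by_cases hj : j = i
      · subst hj
        simp only [Pi.single_eq_same]
        apply isHomogeneous_monomial
        simp at hdeg
        omega
      · simp [Pi.single_eq_of_ne hj, isHomogeneous_zero]
    · rw [Finset.sum_eq_single i]
      · simp [X, monomial_mul]
      · intro j _ hj; simp [Pi.single_eq_of_ne hj]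
      · simp

lemma normal_form (G : MvPolynomial (Fin 4) K) (h : G.IsHomogeneous 3) :
    ∃ c : Fin 4 → Fin 4 → Fin 4 → K, G = ∑ i, X i * ∑ j, X j * ∑ k, X k * C (c i j k) := by
  obtain ⟨Q, hQ, rfl⟩ := hom_succ 2 G h
  choose R hR hR' using fun i => hom_succ 1 (Q i) (hQ i)
  choose S hS hS' using fun i j => hom_succ 0 (R i j) (hR i j)
  refine ⟨fun i j k => coeff 0 (S i j k), ?_⟩
  refine Finset.sum_congr rfl fun i _ => ?_
  rw [hR' i]
  congr 1
  refine Finset.sum_congr rfl fun j _ => ?_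
  rw [hS' i j]
  congr 1
  refine Finset.sum_congr rfl fun k _ => ?_
  congr 1
  exact (totalDegree_eq_zero_iff_eq_C).1 (Nat.le_zero.1 (hS i j k).totalDegree_le)

def cub (a000 a111 a222 a333 a001 a002 a003 a110 a112 a113 a220 a221 a223 a330 a331 a332
  a012 a013 a023 a123 : K) : MvPolynomial (Fin 4) K :=
  C a000 * X 0 ^ 3 + C a111 * X 1 ^ 3 + C a222 * X 2 ^ 3 + C a333 * X 3 ^ 3
  + C a001 * (X 0 ^ 2 * X 1) + C a002 * (X 0 ^ 2 * X 2) + C a003 * (X 0 ^ 2 * X 3)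
  + C a110 * (X 1 ^ 2 * X 0) + C a112 * (X 1 ^ 2 * X 2) + C a113 * (X 1 ^ 2 * X 3)
  + C a220 * (X 2 ^ 2 * X 0) + C a221 * (X 2 ^ 2 * X 1) + C a223 * (X 2 ^ 2 * X 3)
  + C a330 * (X 3 ^ 2 * X 0) + C a331 * (X 3 ^ 2 * X 1) + C a332 * (X 3 ^ 2 * X 2)
  + C a012 * (X 0 * X 1 * X 2) + C a013 * (X 0 * X 1 * X 3)
  + C a023 * (X 0 * X 2 * X 3) + C a123 * (X 1 * X 2 * X 3)

lemma normal_form' (G : MvPolynomial (Fin 4) K) (h : G.IsHomogeneous 3) :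
    ∃ a000 a111 a222 a333 a001 a002 a003 a110 a112 a113 a220 a221 a223 a330 a331 a332
      a012 a013 a023 a123 : K, G = cub a000 a111 a222 a333 a001 a002 a003 a110 a112 a113 a220
        a221 a223 a330 a331 a332 a012 a013 a023 a123 := by
  obtain ⟨c, rfl⟩ := normal_form G h
  refine ⟨c 0 0 0, c 1 1 1, c 2 2 2, c 3 3 3,
    c 0 0 1 + c 0 1 0 + c 1 0 0, c 0 0 2 + c 0 2 0 + c 2 0 0, c 0 0 3 + c 0 3 0 + c 3 0 0,
    c 1 1 0 + c 1 0 1 + c 0 1 1, c 1 1 2 + c 1 2 1 + c 2 1 1, c 1 1 3 + c 1 3 1 + c 3 1 1,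
    c 2 2 0 + c 2 0 2 + c 0 2 2, c 2 2 1 + c 2 1 2 + c 1 2 2, c 2 2 3 + c 2 3 2 + c 3 2 2,
    c 3 3 0 + c 3 0 3 + c 0 3 3, c 3 3 1 + c 3 1 3 + c 1 3 3, c 3 3 2 + c 3 2 3 + c 2 3 3,
    c 0 1 2 + c 0 2 1 + c 1 0 2 + c 1 2 0 + c 2 0 1 + c 2 1 0,
    c 0 1 3 + c 0 3 1 + c 1 0 3 + c 1 3 0 + c 3 0 1 + c 3 1 0,
    c 0 2 3 + c 0 3 2 + c 2 0 3 + c 2 3 0 + c 3 0 2 + c 3 2 0,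
    c 1 2 3 + c 1 3 2 + c 2 1 3 + c 2 3 1 + c 3 1 2 + c 3 2 1, ?_⟩
  simp only [cub, Fin.sum_univ_four, C_add]
  ring

lemma cub_sg (a000 a111 a222 a333 a001 a002 a003 a110 a112 a113 a220 a221 a223 a330 a331 a332
      a012 a013 a023 a123 : K) (x0 x1 x2 x3 : K) : Sg (cub a000 a111 a222 a333 a001 a002 a003 a110
        a112 a113 a220 a221 a223 a330 a331 a332 a012 a013 a023 a123) ![x0, x1, x2, x3] ↔
    (a000 * x0 ^ 3 + a111 * x1 ^ 3 + a222 * x2 ^ 3 + a333 * x3 ^ 3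
  + a001 * (x0 ^ 2 * x1) + a002 * (x0 ^ 2 * x2) + a003 * (x0 ^ 2 * x3)
  + a110 * (x1 ^ 2 * x0) + a112 * (x1 ^ 2 * x2) + a113 * (x1 ^ 2 * x3)
  + a220 * (x2 ^ 2 * x0) + a221 * (x2 ^ 2 * x1) + a223 * (x2 ^ 2 * x3)
  + a330 * (x3 ^ 2 * x0) + a331 * (x3 ^ 2 * x1) + a332 * (x3 ^ 2 * x2)
  + a012 * (x0 * x1 * x2) + a013 * (x0 * x1 * x3)
  + a023 * (x0 * x2 * x3) + a123 * (x1 * x2 * x3) = 0 ∧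
   (3 * a000 * x0 ^ 2 + 2 * a001 * x0 * x1 + 2 * a002 * x0 * x2 + 2 * a003 * x0 * x3
    + a110 * x1 ^ 2 + a220 * x2 ^ 2 + a330 * x3 ^ 2 + a012 * x1 * x2 + a013 * x1 * x3 + a023 * x2 * x3 = 0) ∧
   (3 * a111 * x1 ^ 2 + 2 * a110 * x1 * x0 + 2 * a112 * x1 * x2 + 2 * a113 * x1 * x3
    + a001 * x0 ^ 2 + a221 * x2 ^ 2 + a331 * x3 ^ 2 + a012 * x0 * x2 + a013 * x0 * x3 + a123 * x2 * x3 = 0) ∧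
   (3 * a222 * x2 ^ 2 + 2 * a220 * x2 * x0 + 2 * a221 * x2 * x1 + 2 * a223 * x2 * x3
    + a002 * x0 ^ 2 + a112 * x1 ^ 2 + a332 * x3 ^ 2 + a012 * x0 * x1 + a023 * x0 * x3 + a123 * x1 * x3 = 0) ∧
   (3 * a333 * x3 ^ 2 + 2 * a330 * x3 * x0 + 2 * a331 * x3 * x1 + 2 * a332 * x3 * x2
    + a003 * x0 ^ 2 + a113 * x1 ^ 2 + a223 * x2 ^ 2 + a013 * x0 * x1 + a023 * x0 * x2 + a123 * x1 * x2 = 0)) := by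
  have e1 (x y : K) : x = y → (x = 0 ↔ y = 0) := by rintro rfl; rfl
  rw [Sg, Fin.forall_fin_succ, Fin.forall_fin_succ, Fin.forall_fin_succ, Fin.forall_fin_one]
  refine and_congr (e1 _ _ ?_) (and_congr (e1 _ _ ?_) (and_congr (e1 _ _ ?_) (and_congr (e1 _ _ ?_) (e1 _ _ ?_))))
  · simp [cub]
  all_goals
    simp [cub, Derivation.leibniz, Derivation.leibniz_pow, pderiv_X]
    try ring

lemma cub_X3_false (G Q : MvPolynomial (Fin 4) K) (h : G.IsHomogeneous 3) (hi : Irreducible G)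
    (hG : G = X 3 * Q) : False := by
  rcases hi.isUnit_or_isUnit hG with hu | hu
  · have := (MvPolynomial.isUnit_iff_eq_C_of_isReduced.1 hu)
    obtain ⟨r, hr, h3⟩ := this
    have h4 := congrArg (eval 0) h3
    simp at h4
    simp [← h4] at hr
  · obtain ⟨r, hr, h3⟩ := (MvPolynomial.isUnit_iff_eq_C_of_isReduced.1 hu)
    have h1 : G.IsHomogeneous 1 := by
      rw [hG, h3]; simpa using (isHomogeneous_X K (3 : Fin 4)).mul (isHomogeneous_C (Fin 4) r)
    have := h.inj_right h1 hi.ne_zero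
    omega

lemma coordA (G : MvPolynomial (Fin 4) K) (h : G.IsHomogeneous 3) (hi : Irreducible G)
    (h0 : Sg G ![1, 0, 0, 0]) (h1 : Sg G ![0, 1, 0, 0]) (h2 : Sg G ![0, 0, 1, 0]) (a b d : K)
    (hw : Sg G ![a, b, d, 0]) (hne : a * b ≠ 0 ∨ a * d ≠ 0 ∨ b * d ≠ 0) : False := by
  obtain ⟨a000, a111, a222, a333, a001, a002, a003, a110, a112, a113, a220, a221, a223, a330, a331,
    a332, a012, a013, a023, a123, hG⟩ := normal_form' G h
  rw [hG, cub_sg] at h0 h1 h2 hw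
  simp at h0 h1 h2 
  obtain ⟨rfl, -, rfl, rfl, rfl⟩ := h0
  obtain ⟨rfl, rfl, -, rfl, rfl⟩ := h1
  obtain ⟨rfl, rfl, rfl, -, rfl⟩ := h2
  simp at hw
  have : a012 = 0 := by grind
  subst this
  refine cub_X3_false G (C a333 * X 3 ^ 2 + C a330 * (X 3 * X 0) + C a331 * (X 3 * X 1)
    + C a332 * (X 3 * X 2) + C a013 * (X 0 * X 1)
  + C a023 * (X 0 * X 2) + C a123 * (X 1 * X 2)) h hi ?_
  rw [hG, cub]
  simp only [C_0]
  ring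

lemma coordB (G : MvPolynomial (Fin 4) K) (h : G.IsHomogeneous 3) (hi : Irreducible G)
    (h0 : Sg G ![1, 0, 0, 0]) (h1 : Sg G ![0, 1, 0, 0]) (h2 : Sg G ![0, 0, 1, 0])
    (h3 : Sg G ![0, 0, 0, 1]) (a b c d : K)
    (hw : Sg G ![a, b, c, d]) (ha : a ≠ 0) (hb : b ≠ 0) (hc : c ≠ 0) (hd : d ≠ 0) : False := by
  obtain ⟨a000, a111, a222, a333, a001, a002, a003, a110, a112, a113, a220, a221, a223, a330, a331,
    a332, a012, a013, a023, a123, hG⟩ := normal_form' G h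
  rw [hG, cub_sg] at h0 h1 h2 h3 hw
  simp at h0 h1 h2 h3
  obtain ⟨rfl, -, rfl, rfl, rfl⟩ := h0
  obtain ⟨rfl, rfl, -, rfl, rfl⟩ := h1
  obtain ⟨rfl, rfl, rfl, -, rfl⟩ := h2
  obtain ⟨rfl, rfl, rfl, rfl, -⟩ := h3
  obtain ⟨hw, w0, w1, w2, w3⟩ := hw
  have e0 : a123 * (b * c * d) = 0 := by linear_combination hw - a * w0
  have e1 : a023 * (a * c * d) = 0 := by linear_combination hw - b * w1
  have e2 : a013 * (a * b * d) = 0 := by linear_combination hw - c * w2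
  have e3 : a012 * (a * b * c) = 0 := by linear_combination hw - d * w3
  simp [ha, hb, hc, hd] at e0 e1 e2 e3
  subst e0 e1 e2 e3
  apply hi.ne_zero
  rw [hG, cub]
  simp

lemma coordC (G : MvPolynomial (Fin 4) K) (h : G.IsHomogeneous 3)
    (h0 : Sg G ![1, 0, 0, 0]) (h1 : Sg G ![0, 1, 0, 0]) (a b : K)
    (hw : Sg G ![a, b, 0, 0]) (ha : a ≠ 0) (hb : b ≠ 0) (s t : K) : Sg G ![s, t, 0, 0] := by
  obtain ⟨a000, a111, a222, a333, a001, a002, a003, a110, a112, a113, a220, a221, a223, a330, a331,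
    a332, a012, a013, a023, a123, hG⟩ := normal_form' G h
  rw [hG, cub_sg] at h0 h1 hw ⊢
  simp at h0 h1
  obtain ⟨rfl, -, rfl, rfl, rfl⟩ := h0
  obtain ⟨rfl, rfl, -, rfl, rfl⟩ := h1
  simp [ha, hb] at hw
  simp [hw]

lemma exists_inv (v : Fin 4 → Fin 4 → K) (hv : LinearIndependent K v) :
    ∃ N : Matrix (Fin 4) (Fin 4) K, Matrix.of v * N = 1 ∧ N * Matrix.of v = 1 := by
  have : IsUnit (Matrix.of v) := Matrix.linearIndependent_rows_iff_isUnit.1 hv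
  obtain ⟨u, hu⟩ := this
  exact ⟨(u⁻¹ : _ˣ), by rw [← hu]; simp, by rw [← hu]; simp⟩

lemma vecMul4 (v0 v1 v2 v3 : Fin 4 → K) (a b c d : K) :
    Matrix.vecMul ![a, b, c, d] (Matrix.of ![v0, v1, v2, v3]) =
      a • v0 + b • v1 + c • v2 + d • v3 := by
  ext j
  simp [Matrix.vecMul, dotProduct, Fin.sum_univ_four]

lemma ext3 (v0 v1 v2 : Fin 4 → K) (hv : LinearIndependent K ![v0, v1, v2]) :
    ∃ v3, LinearIndependent K ![v0, v1, v2, v3] := by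
  obtain ⟨x, hx⟩ := exists_linearIndependent_snoc_of_lt_finrank hv (by simp)
  refine ⟨x, ?_⟩
  have e : ![v0, v1, v2, x] = (Fin.snoc ![v0, v1, v2] x : Fin 4 → Fin 4 → K) := by
    ext i j
    fin_cases i <;> rfl
  rw [e]
  exact hx

lemma ext2 (v0 v1 : Fin 4 → K) (hv : LinearIndependent K ![v0, v1]) :
    ∃ v2, LinearIndependent K ![v0, v1, v2] := by
  obtain ⟨x, hx⟩ := exists_linearIndependent_snoc_of_lt_finrank hv (by simp)
  refine ⟨x, ?_⟩
  have e : ![v0, v1, x] = (Fin.snoc ![v0, v1] x : Fin 3 → Fin 4 → K) := by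
    ext i j
    fin_cases i <;> rfl
  rw [e]
  exact hx

lemma not_pair {v w : Fin 4 → K} (c : K) (h : LinearIndependent K ![v, w]) : w ≠ c • v := by
  rintro rfl
  rw [LinearIndependent.pair_iff] at h
  have := h c (-1) (by simp)
  simp at this

lemma lemA (F : MvPolynomial (Fin 4) K) (h : F.IsHomogeneous 3) (hi : Irreducible F)
    (v0 v1 v2 : Fin 4 → K) (hv : LinearIndependent K ![v0, v1, v2])
    (h0 : Sg F v0) (h1 : Sg F v1) (h2 : Sg F v2) (a b d : K)
    (hw : Sg F (a • v0 + b • v1 + d • v2))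
    (i0 : LinearIndependent K ![v0, a • v0 + b • v1 + d • v2])
    (i1 : LinearIndependent K ![v1, a • v0 + b • v1 + d • v2])
    (i2 : LinearIndependent K ![v2, a • v0 + b • v1 + d • v2]) : False := by
  obtain ⟨v3, h3⟩ := ext3 v0 v1 v2 hv
  obtain ⟨N, hN, hN'⟩ := exists_inv _ h3
  refine coordA _ (chg_hom _ F h) (chg_irr _ N hN hN' F hi) (Sg_chg _ _ _ ?_) (Sg_chg _ _ _ ?_)
    (Sg_chg _ _ _ ?_) a b d (Sg_chg _ _ _ ?_) ?_
  · rw [vecMul4]; simpa using h0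
  · rw [vecMul4]; simpa using h1
  · rw [vecMul4]; simpa using h2
  · rw [vecMul4]; simpa using hw
  · have n0 := not_pair a i0
    have n1 := not_pair b i1
    have n2 := not_pair d i2
    by_contra hcon
    push Not at hcon
    obtain ⟨c1, c2, c3⟩ := hcon
    by_cases ha : a = 0
    · subst ha
      by_cases hb : b = 0
      · subst hb; simp at n2
      · have : d = 0 := by simpa [hb] using c3
        subst this; simp at n1
    · have hb : b = 0 := by simpa [ha] using c1
      have hd : d = 0 := by simpa [ha] using c2
      subst hb hd; simp at n0

lemma lemB (F : MvPolynomial (Fin 4) K) (h : F.IsHomogeneous 3) (hi : Irreducible F)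
    (v0 v1 v2 v3 : Fin 4 → K) (hv : LinearIndependent K ![v0, v1, v2, v3])
    (h0 : Sg F v0) (h1 : Sg F v1) (h2 : Sg F v2) (h3 : Sg F v3) (a b c d : K)
    (hw : Sg F (a • v0 + b • v1 + c • v2 + d • v3))
    (ha : a ≠ 0) (hb : b ≠ 0) (hc : c ≠ 0) (hd : d ≠ 0) : False := by
  obtain ⟨N, hN, hN'⟩ := exists_inv _ hv
  refine coordB _ (chg_hom _ F h) (chg_irr _ N hN hN' F hi) (Sg_chg _ _ _ ?_) (Sg_chg _ _ _ ?_)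
    (Sg_chg _ _ _ ?_) (Sg_chg _ _ _ ?_) a b c d (Sg_chg _ _ _ ?_) ha hb hc hd
  · rw [vecMul4]; simpa using h0
  · rw [vecMul4]; simpa using h1
  · rw [vecMul4]; simpa using h2
  · rw [vecMul4]; simpa using h3
  · rw [vecMul4]; simpa using hw

lemma lemC (F : MvPolynomial (Fin 4) K) (h : F.IsHomogeneous 3)
    (v0 v1 : Fin 4 → K) (hv : LinearIndependent K ![v0, v1])
    (h0 : Sg F v0) (h1 : Sg F v1) (a b : K) (hw : Sg F (a • v0 + b • v1))
    (i0 : LinearIndependent K ![v0, a • v0 + b • v1])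
    (i1 : LinearIndependent K ![v1, a • v0 + b • v1]) (s t : K) : Sg F (s • v0 + t • v1) := by
  obtain ⟨v2, h2⟩ := ext2 v0 v1 hv
  obtain ⟨v3, h3⟩ := ext3 v0 v1 v2 h2
  obtain ⟨N, hN, hN'⟩ := exists_inv _ h3
  have hb : b ≠ 0 := by rintro rfl; exact not_pair a i0 (by simp)
  have ha : a ≠ 0 := by rintro rfl; exact not_pair b i1 (by simp)
  have := Sg_of_chg _ N hN hN' F _ (coordC _ (chg_hom _ F h) (Sg_chg _ _ _ (by rw [vecMul4]; simpa using h0))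
    (Sg_chg _ _ _ (by rw [vecMul4]; simpa using h1)) a b
    (Sg_chg _ _ _ (by rw [vecMul4]; simpa using hw)) ha hb s t)
  rw [vecMul4] at this
  simpa using this

/-- dependent third vector -/
lemma dep3 (v0 v1 w : Fin 4 → K) (hv : LinearIndependent K ![v0, v1])
    (hd : ¬ LinearIndependent K ![v0, v1, w]) : ∃ a b : K, w = a • v0 + b • v1 := by
  by_contra hcon
  apply hd
  have : LinearIndependent K (Fin.snoc ![v0, v1] w : Fin 3 → Fin 4 → K) := by
    rw [linearIndependent_finSnoc]
    refine ⟨hv, fun hm => hcon ?_⟩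
    simp only [Matrix.range_cons, Matrix.range_empty, Set.union_empty, Set.singleton_union] at hm
    obtain ⟨a, b, hab⟩ := Submodule.mem_span_pair.1 hm
    exact ⟨a, b, hab.symm⟩
  convert this using 1
  ext i j
  fin_cases i <;> rfl

lemma dep4 (v0 v1 v2 w : Fin 4 → K) (hv : LinearIndependent K ![v0, v1, v2])
    (hd : ¬ LinearIndependent K ![v0, v1, v2, w]) :
    ∃ a b c : K, w = a • v0 + b • v1 + c • v2 := by
  by_contra hcon
  apply hd
  have : LinearIndependent K (Fin.snoc ![v0, v1, v2] w : Fin 4 → Fin 4 → K) := by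
    rw [linearIndependent_finSnoc]
    refine ⟨hv, fun hm => hcon ?_⟩
    simp only [Matrix.range_cons, Matrix.range_empty, Set.union_empty, Set.singleton_union] at hm
    obtain ⟨a, b, c, hab⟩ := Submodule.mem_span_triple.1 hm
    exact ⟨a, b, c, hab.symm⟩
  convert this using 1
  ext i j
  fin_cases i <;> rfl

/-- There are two singular points such that the whole line joining them is singular. -/
lemma exists_sing_line (F : MvPolynomial (Fin 4) K) (h : F.IsHomogeneous 3) (hi : Irreducible F)
    (hinf : {x : Projectivization K (Fin 4 → K) | Sg F x.rep}.Infinite) :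
    ∃ P Q : Projectivization K (Fin 4 → K), Sg F P.rep ∧ Sg F Q.rep ∧
      LinearIndependent K ![P.rep, Q.rep] ∧ ∀ s t : K, Sg F (s • P.rep + t • Q.rep) := by
  have pr {P Q : Projectivization K (Fin 4 → K)} (hne : P ≠ Q) :
      LinearIndependent K ![P.rep, Q.rep] := Projectivization.linearIndependent_pair_iff_ne.2 hne
  by_contra hcon
  have H3 (P Q R : Projectivization K (Fin 4 → K)) (hP : Sg F P.rep) (hQ : Sg F Q.rep)
      (hR : Sg F R.rep) (h1 : P ≠ Q) (h2 : P ≠ R) (h3 : Q ≠ R) :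
      LinearIndependent K ![P.rep, Q.rep, R.rep] := by
    by_contra hd
    obtain ⟨a, b, hab⟩ := dep3 _ _ _ (pr h1) hd
    refine hcon ⟨P, Q, hP, hQ, pr h1, lemC F h _ _ (pr h1) hP hQ a b ?_ ?_ ?_⟩
    · rwa [← hab]
    · rw [← hab]; exact pr h2
    · rw [← hab]; exact pr h3
  have H4 (P Q R W : Projectivization K (Fin 4 → K)) (hP : Sg F P.rep) (hQ : Sg F Q.rep)
      (hR : Sg F R.rep) (hW : Sg F W.rep) (h1 : P ≠ Q) (h2 : P ≠ R) (h3 : Q ≠ R)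
      (h4 : P ≠ W) (h5 : Q ≠ W) (h6 : R ≠ W) (a b c : K)
      (hab : W.rep = a • P.rep + b • Q.rep + c • R.rep) : False := by
    refine lemA F h hi _ _ _ (H3 P Q R hP hQ hR h1 h2 h3) hP hQ hR a b c ?_ ?_ ?_ ?_
    · rwa [← hab]
    · rw [← hab]; exact pr h4
    · rw [← hab]; exact pr h5
    · rw [← hab]; exact pr h6
  let f := hinf.natEmbedding
  have hs (n : ℕ) : Sg F (f n : Projectivization K (Fin 4 → K)).rep := (f n).2
  have hne (m n : ℕ) (hmn : m ≠ n) : (f m : Projectivization K (Fin 4 → K)) ≠ f n := by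
    intro he
    exact hmn (f.injective (Subtype.ext he))
  have n01 := hne 0 1 (by decide)
  have n02 := hne 0 2 (by decide)
  have n03 := hne 0 3 (by decide)
  have n04 := hne 0 4 (by decide)
  have n12 := hne 1 2 (by decide)
  have n13 := hne 1 3 (by decide)
  have n14 := hne 1 4 (by decide)
  have n23 := hne 2 3 (by decide)
  have n24 := hne 2 4 (by decide)
  have n34 := hne 3 4 (by decide)
  by_cases hd : LinearIndependent K ![(f 0).1.rep, (f 1).1.rep, (f 2).1.rep, (f 3).1.rep]
  · obtain ⟨N, hN, hN'⟩ := exists_inv _ hd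
    obtain ⟨a, b, c, d, hw⟩ : ∃ a b c d : K, (f 4).1.rep =
        a • (f 0).1.rep + b • (f 1).1.rep + c • (f 2).1.rep + d • (f 3).1.rep := by
      let x := Matrix.vecMul (f 4).1.rep N
      refine ⟨x 0, x 1, x 2, x 3, ?_⟩
      rw [← vecMul4]
      have : ![x 0, x 1, x 2, x 3] = x := by ext i; fin_cases i <;> rfl
      rw [this]
      simp only [x]
      rw [Matrix.vecMul_vecMul, hN', Matrix.vecMul_one]
    by_cases ha : a = 0
    · exact H4 _ _ _ _ (hs 1) (hs 2) (hs 3) (hs 4) n12 n13 n23 n14 n24 n34 b c d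
        (by rw [hw, ha]; simp)
    by_cases hb : b = 0
    · exact H4 _ _ _ _ (hs 0) (hs 2) (hs 3) (hs 4) n02 n03 n23 n04 n24 n34 a c d
        (by rw [hw, hb]; simp)
    by_cases hc : c = 0
    · exact H4 _ _ _ _ (hs 0) (hs 1) (hs 3) (hs 4) n01 n03 n13 n04 n14 n34 a b d
        (by rw [hw, hc]; simp)
    by_cases hd0 : d = 0
    · exact H4 _ _ _ _ (hs 0) (hs 1) (hs 2) (hs 4) n01 n02 n12 n04 n14 n24 a b c
        (by rw [hw, hd0]; simp)
    exact lemB F h hi _ _ _ _ hd (hs 0) (hs 1) (hs 2) (hs 3) a b c d (by rw [← hw]; exact hs 4)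
      ha hb hc hd0
  · obtain ⟨a, b, c, hw⟩ := dep4 _ _ _ _ (H3 _ _ _ (hs 0) (hs 1) (hs 2) n01 n02 n12) hd
    exact H4 _ _ _ _ (hs 0) (hs 1) (hs 2) (hs 3) n01 n02 n12 n03 n13 n23 a b c hw

end Aux

/-- Over an algebraically closed field of positive characteristic, an
absolutely irreducible cubic surface with infinitely many singular points has as singular
locus exactly a projective line, and this line lies on the surface. -/
theorem statement_3 [IsAlgClosed K] (p : ℕ) (hp : p.Prime) [CharP K p]
    (F : MvPolynomial (Fin 4) K) (hF0 : F ≠ 0) (hhom : F.IsHomogeneous 3)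
    (hirr : Irreducible F)
    (hinf : {x : Projectivization K (Fin 4 → K) | IsSingularAt K F x}.Infinite) :
    ∃ P Q : Projectivization K (Fin 4 → K), P ≠ Q ∧
      {x : Projectivization K (Fin 4 → K) | IsSingularAt K F x} = lineThrough K P Q ∧
      lineThrough K P Q ⊆ projZeros K F := by
  obtain ⟨P, Q, hP, hQ, hPQ, hline⟩ := exists_sing_line F hhom hirr hinf
  have hset : {x : Projectivization K (Fin 4 → K) | IsSingularAt K F x} = lineThrough K P Q := by
    ext R
    constructor
    · intro hR
      by_cases hRP : R = P
      · subst hRP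
        exact ⟨1, 0, by simpa using R.rep_nonzero, by simp⟩
      by_cases hRQ : R = Q
      · subst hRQ
        exact ⟨0, 1, by simpa using R.rep_nonzero, by simp⟩
      by_cases hd : LinearIndependent K ![P.rep, Q.rep, R.rep]
      · exfalso
        refine lemA F hhom hirr _ _ _ hd hP hQ hR 1 1 0 (by simpa using hline 1 1) ?_ ?_ ?_
        · rw [LinearIndependent.pair_iff]
          intro s t hst
          have := LinearIndependent.pair_iff.1 hPQ (s + t) t (by rw [← hst]; module)
          grind
        · rw [LinearIndependent.pair_iff]
          intro s t hst
          have := LinearIndependent.pair_iff.1 hPQ t (s + t) (by rw [← hst]; module)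
          grind
        · rw [LinearIndependent.pair_iff]
          intro s t hst
          have := Fintype.linearIndependent_iff.1 hd ![t, t, s] (by
            rw [← hst]; simp [Fin.sum_univ_three]; module)
          exact ⟨by simpa using this 2, by simpa using this 0⟩
      · obtain ⟨a, b, hab⟩ := dep3 _ _ _ hPQ hd
        refine ⟨a, b, by rw [← hab]; exact R.rep_nonzero, ?_⟩
        simp [← hab]
    · rintro ⟨a, b, h, rfl⟩
      obtain ⟨u, hu⟩ := Projectivization.exists_smul_eq_mk_rep K _ h
      show Sg F _
      rw [← hu]
      have := hline (u * a) (u * b)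
      rwa [mul_smul, mul_smul, ← smul_add] at this
  refine ⟨P, Q, Projectivization.linearIndependent_pair_iff_ne.1 hPQ, hset, ?_⟩
  rw [← hset]
  intro x hx
  exact hx.1
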